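/- Fenchel–Moreau identity on the positive semidefinite cone: let u: S^K_+ → (−∞, +∞] be not identically +∞. Then u** = u (where * denotes the Fenchel transform with supremum over S^K_+) if and only if u is convex, lower semicontinuous, and nondecreasing with respect to the positive semidefinite order. -/

import Mathlib

/-- The Fenchel transform over the positive semidefinite cone, for functions with
values in `(-∞, +∞]` (modelled by `EReal`): `u*(x) = sup_{y ⪰ 0} { tr(yx) − u(y) }`. -/
noncomputable def fconj {K : ℕ} (u : Matrix (Fin K) (Fin K) ℝ → EReal)
    (x : Matrix (Fin K) (Fin K) ℝ) : EReal :=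
  ⨆ y ∈ {y : Matrix (Fin K) (Fin K) ℝ | y.PosSemidef},
    ((((y * x).trace : ℝ) : EReal) - u y)

namespace FM
section
open Matrix Topology

local instance lcMat (K : ℕ) : LocallyConvexSpace ℝ (Matrix (Fin K) (Fin K) ℝ) :=
  inferInstanceAs (LocallyConvexSpace ℝ (Fin K → Fin K → ℝ))

lemma nhds_ent {K : ℕ} {x : Matrix (Fin K) (Fin K) ℝ} {U : Set (Matrix (Fin K) (Fin K) ℝ)}
    (hU : U ∈ 𝓝 x) : ∃ δ > 0, ∀ w : Matrix (Fin K) (Fin K) ℝ, (∀ i j, |w i j - x i j| < δ) → w ∈ U := by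
  obtain ⟨δ, hδ, h⟩ := Metric.mem_nhds_iff.1 (show U ∈ @nhds (Fin K → Fin K → ℝ) _ x from hU)
  refine ⟨δ, hδ, fun w hw => h ?_⟩
  refine (dist_pi_lt_iff hδ).2 fun i => (dist_pi_lt_iff hδ).2 fun j => ?_
  exact hw i j

lemma nhds_ent' {K : ℕ} (x : Matrix (Fin K) (Fin K) ℝ) {δ : ℝ} (hδ : 0 < δ) :
    {w : Matrix (Fin K) (Fin K) ℝ | ∀ i j, |w i j - x i j| < δ} ∈ 𝓝 x := by
  have : Metric.ball (show Fin K → Fin K → ℝ from x) δ ∈ @nhds (Fin K → Fin K → ℝ) _ x := Metric.ball_mem_nhds _ hδ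
  refine Filter.mem_of_superset this fun w hw i j => ?_
  exact (dist_pi_lt_iff hδ).1 ((dist_pi_lt_iff hδ).1 hw i) j

lemma psd_ent {K : ℕ} {Q : Matrix (Fin K) (Fin K) ℝ} (hQ : Q.PosSemidef) (i j : Fin K) :
    |Q i j| ≤ (Q i i + Q j j) / 2 := by
  have h1 := hQ.dotProduct_mulVec_nonneg (Pi.single i 1 + Pi.single j 1)
  have h2 := hQ.dotProduct_mulVec_nonneg (Pi.single i 1 - Pi.single j 1)
  have hs : Q j i = Q i j := by simpa using hQ.isHermitian.apply i j
  simp [mulVec_add, mulVec_sub, add_dotProduct, sub_dotProduct, hs] at h1 h2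
  rw [abs_le]; constructor <;> linarith

lemma psd_of_small {K : ℕ} {D : Matrix (Fin K) (Fin K) ℝ} (hD : D.IsHermitian) {δ ε : ℝ}
    (h : ∀ i j, |D i j| ≤ δ) (hε : K * δ ≤ ε) : (D + ε • 1).PosSemidef := by
  refine PosSemidef.of_dotProduct_mulVec_nonneg (hD.add ?_) fun v => ?_
  · simp [IsHermitian]
  · have e1 : star v ⬝ᵥ (D + ε • 1) *ᵥ v = (∑ i, ∑ j, v i * (D i j * v j)) + ε * ∑ i, v i * v i := by
      rw [add_mulVec, smul_mulVec, one_mulVec, dotProduct_add, dotProduct_smul]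
      simp [dotProduct, mulVec, Finset.mul_sum]
    rw [e1]
    have e2 : ∀ i j, -(δ * ((v i * v i + v j * v j) / 2)) ≤ v i * (D i j * v j) := by
      intro i j
      have hd := abs_le.1 (h i j)
      nlinarith [mul_nonneg (sub_nonneg.2 hd.2) (sq_nonneg (v i - v j)), mul_nonneg (by linarith [hd.1] : 0 ≤ D i j + δ) (sq_nonneg (v i + v j))]
    have e3 : ∑ i, ∑ j, -(δ * ((v i * v i + v j * v j) / 2)) ≤ ∑ i, ∑ j, v i * (D i j * v j) :=
      Finset.sum_le_sum fun i _ => Finset.sum_le_sum fun j _ => e2 i j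
    have e4 : ∑ i : Fin K, ∑ j : Fin K, -(δ * ((v i * v i + v j * v j) / 2)) = -(K * δ) * ∑ i, v i * v i := by
      simp only [Finset.sum_neg_distrib, ← Finset.mul_sum, ← Finset.sum_div, Finset.sum_add_distrib, Finset.sum_const, Finset.card_univ, Fintype.card_fin, nsmul_eq_mul]
      ring_nf
      rw [← Finset.sum_mul]
      ring
    have e5 : 0 ≤ ∑ i, v i * v i := Finset.sum_nonneg fun i _ => mul_self_nonneg _
    nlinarith

lemma key {K : ℕ} {x z : Matrix (Fin K) (Fin K) ℝ} (hx : x.PosSemidef) (hz : z.PosSemidef)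
    {ε : ℝ} (hε : 0 < ε) (h : (z + ε • 1 - x).PosSemidef) :
    ∃ w : Matrix (Fin K) (Fin K) ℝ, w.PosSemidef ∧ (z - w).PosSemidef ∧
      ∀ i j, |w i j - x i j| ≤ 2 * √(ε * x.trace) + ε := by
  have hPd : (z + ε • 1 : Matrix (Fin K) (Fin K) ℝ).PosDef := (PosDef.one.smul hε).posSemidef_add hz
  set P : Matrix (Fin K) (Fin K) ℝ := z + ε • 1 with hP
  have hu := hPd.isUnit
  have hdet := (isUnit_iff_isUnit_det _).1 hu
  obtain ⟨R, hR⟩ : ∃ R, R = P⁻¹ := ⟨_, rfl⟩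
  have hPR : P * R = 1 := by rw [hR]; exact mul_nonsing_inv _ hdet
  have hRP : R * P = 1 := by rw [hR]; exact nonsing_inv_mul _ hdet
  have hRpsd : R.PosSemidef := by rw [hR]; exact hPd.posSemidef.inv
  have hRh : Rᴴ = R := hRpsd.isHermitian
  have hxh : xᴴ = x := hx.isHermitian
  have hzh : zᴴ = z := hz.isHermitian
  have hzR : z * R = 1 - ε • R := by
    have : z = P - ε • 1 := by simp [hP]
    rw [this, sub_mul, hPR]; simp
  have hRz : R * z = 1 - ε • R := by
    have : z = P - ε • 1 := by simp [hP]
    rw [this, mul_sub, hRP]; simp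
  set N := ε • (R * x) with hN
  set Q := ε • ε • (R * x * R) with hQ
  have hNT : Nᴴ = ε • (x * R) := by
    rw [hN, conjTranspose_smul, conjTranspose_mul, hRh, hxh]; simp
  have hw : z * R * x * (R * z) = x - N - Nᴴ + Q := by
    rw [hNT, hN, hQ, hzR, hRz]
    simp only [sub_mul, mul_sub, one_mul, mul_one, smul_mul_assoc, mul_smul_comm, mul_assoc, smul_sub]
    module
  have hQpsd : Q.PosSemidef := by
    have := hx.mul_mul_conjTranspose_same R
    rw [hRh] at this
    exact (this.smul hε.le).smul hε.le
  have hC := h.mul_mul_conjTranspose_same R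
  rw [hRh] at hC
  have hC' : R * (P - x) * R = R - R * x * R := by rw [mul_sub, sub_mul, hRP, one_mul]
  have hNN : (ε • x - Nᴴ * N).PosSemidef := by
    have a1 := hx.mul_mul_conjTranspose_same (1 - x * R)
    have a2 := hC.mul_mul_conjTranspose_same x
    have a3 := hz.mul_mul_conjTranspose_same (x * R)
    have := ((a1.add a2).add a3).smul hε.le
    convert this using 1
    rw [hNT, hN, hC']
    have e : R * (z * (R * x)) = R * x - ε • (R * (R * x)) := by
      rw [← mul_assoc, hRz, sub_mul, one_mul, smul_mul_assoc]
    simp only [conjTranspose_sub, conjTranspose_mul, conjTranspose_one, hRh, hxh, mul_assoc, sub_mul, mul_sub, one_mul, mul_one, e, smul_add, smul_sub, smul_mul_assoc, mul_smul_comm]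
    abel
  have hQb : (ε • 1 - Q).PosSemidef := by
    have a1 := (posSemidef_self_mul_conjTranspose (R * z)).smul hε.le
    have a2 := (hz.mul_mul_conjTranspose_same R).smul (mul_pos hε hε).le
    have a3 := hC.smul (mul_pos hε hε).le
    convert (a1.add a2).add a3 using 1
    rw [hC', hRh, conjTranspose_mul, hzh, hRh, hRz, hzR, hQ]
    simp only [sub_mul, mul_sub, one_mul, mul_one, smul_sub, smul_mul_assoc, mul_smul_comm, smul_smul]
    module
  refine ⟨z * R * x * (R * z), ?_, ?_, ?_⟩
  · have := hx.mul_mul_conjTranspose_same (z * R)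
    rwa [conjTranspose_mul, hRh, hzh] at this
  · have a1 := hC.mul_mul_conjTranspose_same z
    have a2 := (hz.mul_mul_conjTranspose_same R).smul hε.le
    have a3 := (posSemidef_self_mul_conjTranspose (R * z)).smul hε.le
    have e : z - z * R * x * (R * z) = z * (R * (P - x) * R) * zᴴ + ε • (R * z * (R * z)ᴴ) + ε • ε • (R * z * Rᴴ) := by
      have e1 : z * (R * (P - x) * R) * z = z * (R * z) - z * R * x * (R * z) := by
        rw [hC']; simp only [sub_mul, mul_sub, mul_assoc]
      rw [hzh, e1, conjTranspose_mul, hRh, hzh, hRz, hzR]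
      have e2 : z * (1 - ε • R) = z - ε • (1 - ε • R) := by
        rw [mul_sub, mul_one, mul_smul_comm, hzR]
      rw [e2]
      simp only [sub_mul, mul_sub, one_mul, mul_one, smul_sub, smul_mul_assoc, mul_smul_comm, smul_smul]
      module
    rw [e]
    exact (a1.add a3).add (a2.smul hε.le)
  · intro i j
    rw [hw]
    have bN : ∀ i j, |N i j| ≤ √(ε * x.trace) := by
      intro i j
      apply Real.abs_le_sqrt
      have h1 := hNN.diag_nonneg (i := j)
      have h2 : (Nᴴ * N) j j = ∑ k, N k j ^ 2 := by simp [mul_apply, sq]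
      have h3 : N i j ^ 2 ≤ ∑ k, N k j ^ 2 := Finset.single_le_sum (f := fun k => N k j ^ 2) (fun k _ => sq_nonneg _) (Finset.mem_univ i)
      have h4 : x j j ≤ x.trace := Finset.single_le_sum (f := fun k => x k k) (fun k _ => hx.diag_nonneg) (Finset.mem_univ j)
      simp only [Matrix.sub_apply, Matrix.smul_apply, smul_eq_mul, h2] at h1
      nlinarith
    have bQd : ∀ i, Q i i ≤ ε := by
      intro i
      have := hQb.diag_nonneg (i := i)
      simp only [Matrix.sub_apply, Matrix.smul_apply, one_apply_eq, smul_eq_mul] at this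
      linarith
    have bQ := psd_ent hQpsd i j
    have q1 := bQd i
    have q2 := bQd j
    have n1 := bN i j
    have n2 := bN j i
    have : (x - N - Nᴴ + Q) i j - x i j = -N i j - N j i + Q i j := by
      simp; ring
    rw [this]
    rw [abs_le] at *
    constructor <;> linarith

lemma trace_mul_nonneg' {K : ℕ} {x y : Matrix (Fin K) (Fin K) ℝ} (hx : x.PosSemidef)
    (hy : y.PosSemidef) : 0 ≤ (x * y).trace := by
  open scoped MatrixOrder Matrix.Norms.L2Operator in
  obtain ⟨B, rfl⟩ := CStarAlgebra.nonneg_iff_eq_star_mul_self.mp hy.nonneg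
  rw [← mul_assoc, trace_mul_comm, star_eq_conjTranspose, ← mul_assoc]
  exact (hx.mul_mul_conjTranspose_same B).trace_nonneg

/-- the hypograph-type set -/
def epiE {K : ℕ} (u : Matrix (Fin K) (Fin K) ℝ → EReal) : Set (Matrix (Fin K) (Fin K) ℝ × ℝ) :=
  {p | ∃ z : Matrix (Fin K) (Fin K) ℝ, z.PosSemidef ∧ u z ≤ (p.2 : EReal) ∧ (z - p.1).PosSemidef}

lemma ereal_cvx {a b s t : ℝ} {p q : EReal} (ha : 0 ≤ a) (hb : 0 ≤ b) (hp : p ≤ s) (hq : q ≤ t) :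
    (a : EReal) * p + (b : EReal) * q ≤ ((a * s + b * t : ℝ) : EReal) := by
  rw [EReal.coe_add, EReal.coe_mul, EReal.coe_mul]
  exact add_le_add (mul_le_mul_of_nonneg_left hp (EReal.coe_nonneg.2 ha))
    (mul_le_mul_of_nonneg_left hq (EReal.coe_nonneg.2 hb))

lemma not_mem_closure {K : ℕ} {u : Matrix (Fin K) (Fin K) ℝ → EReal}
    (hl : LowerSemicontinuousOn u {x : Matrix (Fin K) (Fin K) ℝ | x.PosSemidef})
    (hm : ∀ a b : Matrix (Fin K) (Fin K) ℝ, a.PosSemidef → b.PosSemidef →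
        (a - b).PosSemidef → u b ≤ u a)
    {x : Matrix (Fin K) (Fin K) ℝ} (hx : x.PosSemidef) {t : ℝ} (ht : (t : EReal) < u x) :
    (x, t) ∉ closure (epiE u) := by
  obtain ⟨t', h1, h2⟩ := EReal.lt_iff_exists_real_btwn.1 ht
  have h3 := hl x hx t' h2
  obtain ⟨δ, hδ, hU⟩ := nhds_ent (mem_nhdsWithin_iff_eventually.1 h3)
  obtain ⟨ε, hε, hεδ⟩ : ∃ ε > 0, 2 * √(ε * x.trace) + ε < δ := by
    have hc : Filter.Tendsto (fun ε : ℝ => 2 * √(ε * x.trace) + ε) (𝓝[>] 0) (𝓝 0) := by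
      have : Continuous (fun ε : ℝ => 2 * √(ε * x.trace) + ε) := by fun_prop
      have := this.tendsto 0
      simp only [zero_mul, Real.sqrt_zero, mul_zero, add_zero] at this
      exact this.mono_left nhdsWithin_le_nhds
    obtain ⟨ε, h, h'⟩ := ((hc.eventually (gt_mem_nhds hδ)).and self_mem_nhdsWithin).exists
    exact ⟨ε, h', h⟩
  have hη : 0 < ε / (K + 1) := by positivity
  rw [mem_closure_iff_nhds]
  push Not
  refine ⟨_, prod_mem_nhds (nhds_ent' x hη) (Iio_mem_nhds (EReal.coe_lt_coe_iff.1 h1)), ?_⟩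
  rw [Set.eq_empty_iff_forall_notMem]
  rintro ⟨w, s⟩ ⟨⟨hw, hs⟩, z, hz, hzs, hzw⟩
  simp only [Set.mem_ofPred_eq, Set.mem_Iio] at hw hs hzs hzw
  have hwh : w.IsHermitian := by
    have := hz.isHermitian.sub hzw.isHermitian
    simpa using this
  have hd : ((w - x) + ε • 1).PosSemidef := by
    refine psd_of_small (hwh.sub hx.isHermitian) (δ := ε / (K + 1)) (fun i j => (hw i j).le) ?_
    rw [mul_div_assoc', div_le_iff₀ (by positivity)]
    nlinarith
  have hzx : (z + ε • 1 - x).PosSemidef := by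
    convert hzw.add hd using 1
    abel
  obtain ⟨w', p1, p2, p3⟩ := key hx hz hε hzx
  have q1 : (t' : EReal) < u w' := hU w' (fun i j => (p3 i j).trans_lt hεδ) p1
  have q2 := hm z w' hz p1 p2
  have := (q1.trans_le (q2.trans hzs))
  exact absurd (EReal.coe_lt_coe_iff.1 this) (not_lt.2 hs.le)

lemma convex_epiE {K : ℕ} {u : Matrix (Fin K) (Fin K) ℝ → EReal}
    (hc : ∀ x y : Matrix (Fin K) (Fin K) ℝ, x.PosSemidef → y.PosSemidef →
        ∀ a b : ℝ, 0 ≤ a → 0 ≤ b → a + b = 1 →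
          u (a • x + b • y) ≤ ((a : ℝ) : EReal) * u x + ((b : ℝ) : EReal) * u y) :
    Convex ℝ (epiE u) := by
  rintro ⟨w, s⟩ ⟨z, hz, h1, h2⟩ ⟨w', s'⟩ ⟨z', hz', h1', h2'⟩ a b ha hb hab
  refine ⟨a • z + b • z', (hz.smul ha).add (hz'.smul hb),
    (hc z z' hz hz' a b ha hb hab).trans (ereal_cvx ha hb h1 h1'), ?_⟩
  convert (h2.smul ha).add (h2'.smul hb) using 1
  simp only [Prod.fst_add, Prod.smul_fst, smul_sub]
  abel

lemma exists_rep {K : ℕ} (φ : Matrix (Fin K) (Fin K) ℝ →ₗ[ℝ] ℝ) :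
    ∃ y : Matrix (Fin K) (Fin K) ℝ, y.IsHermitian ∧ ∀ w : Matrix (Fin K) (Fin K) ℝ, w.IsHermitian →
      (y * w).trace = φ w := by
  have hφ : ∀ w, φ w = ∑ i, ∑ j, w i j * φ (Matrix.single i j 1) := by
    intro w
    conv_lhs => rw [matrix_eq_sum_single w]
    simp only [map_sum]
    refine Finset.sum_congr rfl fun i _ => Finset.sum_congr rfl fun j _ => ?_
    rw [← smul_eq_mul, ← map_smul, smul_single, smul_eq_mul, mul_one]
  refine ⟨Matrix.of fun i j => (φ (Matrix.single i j 1) + φ (Matrix.single j i 1)) / 2, ?_, ?_⟩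
  · ext i j
    simp [add_comm]
  · intro w hw
    have hs : ∀ i j, w j i = w i j := fun i j => by simpa using hw.apply i j
    have e : φ w = ∑ i, ∑ j, w i j * φ (Matrix.single j i 1) := by
      rw [hφ, Finset.sum_comm]
      refine Finset.sum_congr rfl fun i _ => Finset.sum_congr rfl fun j _ => ?_
      rw [hs]
    have e' : φ w = (∑ i, ∑ j, w i j * φ (Matrix.single i j 1) + ∑ i, ∑ j, w i j * φ (Matrix.single j i 1)) / 2 := by
      rw [← e, ← hφ]; ring
    rw [e', ← Finset.sum_add_distrib, Finset.sum_div]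
    simp only [trace, diag_apply, mul_apply, of_apply]
    refine Finset.sum_congr rfl fun i _ => ?_
    rw [← Finset.sum_add_distrib, Finset.sum_div]
    refine Finset.sum_congr rfl fun j _ => ?_
    rw [hs]; ring

lemma nonneg_of_bdd {p q c : ℝ} (h : ∀ n : ℝ, 0 ≤ n → p - n * q < c) : 0 ≤ q := by
  by_contra hq
  push Not at hq
  have h0 := h 0 le_rfl
  have h1 := h ((p - c) / q) (div_nonneg_of_nonpos (by linarith) hq.le)
  rw [div_mul_cancel₀ _ hq.ne] at h1
  linarith

lemma sep {K : ℕ} {u : Matrix (Fin K) (Fin K) ℝ → EReal}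
    (hc : ∀ x y : Matrix (Fin K) (Fin K) ℝ, x.PosSemidef → y.PosSemidef →
        ∀ a b : ℝ, 0 ≤ a → 0 ≤ b → a + b = 1 →
          u (a • x + b • y) ≤ ((a : ℝ) : EReal) * u x + ((b : ℝ) : EReal) * u y)
    (hl : LowerSemicontinuousOn u {x : Matrix (Fin K) (Fin K) ℝ | x.PosSemidef})
    (hm : ∀ a b : Matrix (Fin K) (Fin K) ℝ, a.PosSemidef → b.PosSemidef →
        (a - b).PosSemidef → u b ≤ u a)
    {x₀ : Matrix (Fin K) (Fin K) ℝ} (hx₀ : x₀.PosSemidef) {s₀ : ℝ} (hs₀ : u x₀ ≤ s₀)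
    {x : Matrix (Fin K) (Fin K) ℝ} (hx : x.PosSemidef) {t : ℝ} (ht : (t : EReal) < u x) :
    ∃ (y : Matrix (Fin K) (Fin K) ℝ) (α γ : ℝ), y.PosSemidef ∧ 0 ≤ α ∧
      (∀ z : Matrix (Fin K) (Fin K) ℝ, z.PosSemidef → ∀ s : ℝ, u z ≤ s → (y * z).trace - α * s < γ) ∧
      γ < (y * x).trace - α * t := by
  obtain ⟨f, γ, hf, hfx⟩ := geometric_hahn_banach_closed_point (convex_epiE hc).closure isClosed_closure
    (not_mem_closure hl hm hx ht)
  obtain ⟨y, hyh, hy⟩ := exists_rep (f.toLinearMap ∘ₗ LinearMap.inl ℝ _ _)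
  have hfe : ∀ w : Matrix (Fin K) (Fin K) ℝ, w.IsHermitian → ∀ s : ℝ,
      f (w, s) = (y * w).trace - (-f (0, 1)) * s := by
    intro w hw s
    have : (w, s) = (w, (0 : ℝ)) + s • ((0 : Matrix (Fin K) (Fin K) ℝ), (1 : ℝ)) := by simp
    rw [hy w hw, this, map_add, map_smul]
    simp
    ring
  have hE : ∀ z w : Matrix (Fin K) (Fin K) ℝ, z.PosSemidef → (z - w).PosSemidef → ∀ s : ℝ, u z ≤ s →
      (y * w).trace - (-f (0, 1)) * s < γ := by
    intro z w hz hzw s hs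
    have hwh : w.IsHermitian := by
      have := hz.isHermitian.sub hzw.isHermitian
      simpa using this
    rw [← hfe w hwh]
    exact hf _ (subset_closure ⟨z, hz, hs, hzw⟩)
  refine ⟨y, -f (0, 1), γ, ?_, ?_, ?_, ?_⟩
  · refine PosSemidef.of_dotProduct_mulVec_nonneg hyh fun v => ?_
    have hv := posSemidef_vecMulVec_self_star v
    have e : star v ⬝ᵥ y *ᵥ v = (y * vecMulVec v (star v)).trace := by
      rw [mul_vecMulVec, trace_vecMulVec, dotProduct_comm]
    rw [e]
    refine nonneg_of_bdd (p := (y * x₀).trace - (-f (0, 1)) * s₀) (c := γ) fun n hn => ?_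
    have := hE x₀ (x₀ - n • vecMulVec v (star v)) hx₀ (by simpa using hv.smul hn) s₀ hs₀
    rw [mul_sub, trace_sub, mul_smul_comm, trace_smul, smul_eq_mul] at this
    linarith
  · refine nonneg_of_bdd (p := (y * x₀).trace - (-f (0, 1)) * s₀) (c := γ) fun n hn => ?_
    have := hE x₀ x₀ hx₀ (by simpa using PosSemidef.zero) (s₀ + n)
      (hs₀.trans (EReal.coe_le_coe_iff.2 (by linarith)))
    linarith
  · intro z hz s hs
    exact hE z z hz (by simpa using PosSemidef.zero) s hs
  · rw [← hfe x hx.isHermitian]; exact hfx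

lemma minorant {K : ℕ} {u : Matrix (Fin K) (Fin K) ℝ → EReal}
    (hc : ∀ x y : Matrix (Fin K) (Fin K) ℝ, x.PosSemidef → y.PosSemidef →
        ∀ a b : ℝ, 0 ≤ a → 0 ≤ b → a + b = 1 →
          u (a • x + b • y) ≤ ((a : ℝ) : EReal) * u x + ((b : ℝ) : EReal) * u y)
    (hl : LowerSemicontinuousOn u {x : Matrix (Fin K) (Fin K) ℝ | x.PosSemidef})
    (hm : ∀ a b : Matrix (Fin K) (Fin K) ℝ, a.PosSemidef → b.PosSemidef →
        (a - b).PosSemidef → u b ≤ u a)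
    {x₀ : Matrix (Fin K) (Fin K) ℝ} (hx₀ : x₀.PosSemidef) {s₀ : ℝ} (hs₀ : u x₀ = s₀)
    {x : Matrix (Fin K) (Fin K) ℝ} (hx : x.PosSemidef) {t : ℝ} (ht : (t : EReal) < u x) :
    ∃ (y : Matrix (Fin K) (Fin K) ℝ) (c : ℝ), y.PosSemidef ∧
      (∀ z : Matrix (Fin K) (Fin K) ℝ, z.PosSemidef → ∀ s : ℝ, u z ≤ s → (y * z).trace - s ≤ c) ∧
      t ≤ (y * x).trace - c := by
  have norm1 : ∀ {x : Matrix (Fin K) (Fin K) ℝ} {t : ℝ} (y : Matrix (Fin K) (Fin K) ℝ) (α γ : ℝ), y.PosSemidef → 0 < α →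
      (∀ z : Matrix (Fin K) (Fin K) ℝ, z.PosSemidef → ∀ s : ℝ, u z ≤ s → (y * z).trace - α * s < γ) →
      γ < (y * x).trace - α * t → ∃ (y : Matrix (Fin K) (Fin K) ℝ) (c : ℝ), y.PosSemidef ∧
      (∀ z : Matrix (Fin K) (Fin K) ℝ, z.PosSemidef → ∀ s : ℝ, u z ≤ s → (y * z).trace - s ≤ c) ∧
      t ≤ (y * x).trace - c := by
    intro x t y α γ hy hα h1 h2
    refine ⟨α⁻¹ • y, α⁻¹ * γ, hy.smul (inv_pos.2 hα).le, fun z hz s hs => ?_, ?_⟩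
    · have := mul_le_mul_of_nonneg_left (h1 z hz s hs).le (inv_pos.2 hα).le
      rw [mul_sub, inv_mul_cancel_left₀ hα.ne'] at this
      simpa using this
    · have := mul_le_mul_of_nonneg_left h2.le (inv_pos.2 hα).le
      rw [mul_sub, inv_mul_cancel_left₀ hα.ne'] at this
      simp only [smul_mul_assoc, trace_smul, smul_eq_mul]
      linarith
  obtain ⟨y, α, γ, hy, hα, h1, h2⟩ := sep hc hl hm hx₀ hs₀.le hx ht
  rcases hα.lt_or_eq with hα | hα
  · exact norm1 y α γ hy hα h1 h2
  subst hα
  obtain ⟨y₁, α₁, γ₁, hy₁, hα₁, h1₁, h2₁⟩ := sep hc hl hm hx₀ hs₀.le hx₀ (t := s₀ - 1)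
    (by rw [hs₀]; exact EReal.coe_lt_coe_iff.2 (by linarith))
  have hα₁' : 0 < α₁ := by
    have := h1₁ x₀ hx₀ s₀ hs₀.le
    linarith
  obtain ⟨y₂, c, hy₂, hb, -⟩ := norm1 y₁ α₁ γ₁ hy₁ hα₁' h1₁ h2₁
  simp only [zero_mul, sub_zero] at h1 h2
  obtain ⟨n, hn⟩ := exists_nat_ge ((t + c - (y₂ * x).trace) / ((y * x).trace - γ))
  rw [div_le_iff₀ (by linarith)] at hn
  refine ⟨y₂ + (n : ℝ) • y, c + n * γ, hy₂.add (hy.smul n.cast_nonneg), fun z hz s hs => ?_, ?_⟩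
  · have a := hb z hz s hs
    have b := mul_le_mul_of_nonneg_left (h1 z hz s hs).le (n.cast_nonneg (α := ℝ))
    simp only [add_mul, trace_add, smul_mul_assoc, trace_smul, smul_eq_mul]
    linarith
  · simp only [add_mul, trace_add, smul_mul_assoc, trace_smul, smul_eq_mul]
    linarith

lemma le_fconj {K : ℕ} (u : Matrix (Fin K) (Fin K) ℝ → EReal) (x : Matrix (Fin K) (Fin K) ℝ)
    {y : Matrix (Fin K) (Fin K) ℝ} (hy : y.PosSemidef) :
    (((y * x).trace : ℝ) : EReal) - u y ≤ fconj u x :=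
  le_iSup₂ (f := fun (y : Matrix (Fin K) (Fin K) ℝ)
    (_ : y ∈ {y : Matrix (Fin K) (Fin K) ℝ | y.PosSemidef}) =>
      (((y * x).trace : ℝ) : EReal) - u y) y hy

lemma fconj_le {K : ℕ} (u : Matrix (Fin K) (Fin K) ℝ → EReal) (x : Matrix (Fin K) (Fin K) ℝ)
    {c : EReal} (h : ∀ y : Matrix (Fin K) (Fin K) ℝ, y.PosSemidef →
      (((y * x).trace : ℝ) : EReal) - u y ≤ c) : fconj u x ≤ c :=
  iSup₂_le h

lemma fconj_convex {K : ℕ} (v : Matrix (Fin K) (Fin K) ℝ → EReal) (hv : ∀ y, v y ≠ ⊥)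
    (x y : Matrix (Fin K) (Fin K) ℝ) (a b : ℝ) (ha : 0 ≤ a) (hb : 0 ≤ b) (hab : a + b = 1) :
    fconj v (a • x + b • y) ≤ ((a : ℝ) : EReal) * fconj v x + ((b : ℝ) : EReal) * fconj v y := by
  refine fconj_le _ _ fun w hw => ?_
  have h1 := le_fconj v x hw
  have h2 := le_fconj v y hw
  have hvw := hv w
  induction hc : v w with
  | bot => exact absurd hc hvw
  | top => simp
  | coe c =>
    rw [hc, ← EReal.coe_sub] at h1 h2
    have e : (((w * (a • x + b • y)).trace : ℝ) : EReal) - (c : EReal) =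
        (a : EReal) * (((w * x).trace - c : ℝ) : EReal) + (b : EReal) * (((w * y).trace - c : ℝ) : EReal) := by
      rw [← EReal.coe_sub, ← EReal.coe_mul, ← EReal.coe_mul, ← EReal.coe_add]
      congr 1
      simp only [mul_add, mul_smul_comm, trace_add, trace_smul, smul_eq_mul]
      linear_combination (-c) * (1 - hab)
    rw [e]
    exact add_le_add (mul_le_mul_of_nonneg_left h1 (EReal.coe_nonneg.2 ha))
      (mul_le_mul_of_nonneg_left h2 (EReal.coe_nonneg.2 hb))

lemma fconj_lsc {K : ℕ} (v : Matrix (Fin K) (Fin K) ℝ → EReal) (hv : ∀ y, v y ≠ ⊥) :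
    LowerSemicontinuousOn (fconj v) {x : Matrix (Fin K) (Fin K) ℝ | x.PosSemidef} := by
  refine lowerSemicontinuousOn_biSup fun w _ => ?_
  refine LowerSemicontinuous.lowerSemicontinuousOn ?_ _
  have hvw := hv w
  refine Continuous.lowerSemicontinuous ?_
  induction hc : v w with
  | bot => exact absurd hc hvw
  | top => simpa using continuous_const
  | coe c =>
    simp only [← EReal.coe_sub]
    refine continuous_coe_real_ereal.comp ?_
    fun_prop

lemma fconj_mono {K : ℕ} (v : Matrix (Fin K) (Fin K) ℝ → EReal)
    (a b : Matrix (Fin K) (Fin K) ℝ) (hab : (a - b).PosSemidef) : fconj v b ≤ fconj v a := by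
  refine fconj_le _ _ fun w hw => le_trans (EReal.sub_le_sub ?_ le_rfl) (le_fconj v a hw)
  have := trace_mul_nonneg' hw hab
  rw [mul_sub, trace_sub] at this
  exact EReal.coe_le_coe_iff.2 (by linarith)

end
end FM

/-- Fenchel–Moreau identity on the positive semidefinite cone: for
`u : S^K_+ → (−∞,+∞]` not identically `+∞`, one has `u** = u` on the cone if and only
if `u` is convex, lower semicontinuous and nondecreasing (for the PSD order) there. -/
theorem stmt7 (K : ℕ) (u : Matrix (Fin K) (Fin K) ℝ → EReal)
    (hbot : ∀ x : Matrix (Fin K) (Fin K) ℝ, x.PosSemidef → u x ≠ ⊥)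
    (hne : ∃ x : Matrix (Fin K) (Fin K) ℝ, x.PosSemidef ∧ u x ≠ ⊤) :
    (∀ x : Matrix (Fin K) (Fin K) ℝ, x.PosSemidef → fconj (fconj u) x = u x) ↔
      ((∀ x y : Matrix (Fin K) (Fin K) ℝ, x.PosSemidef → y.PosSemidef →
        ∀ a b : ℝ, 0 ≤ a → 0 ≤ b → a + b = 1 →
          u (a • x + b • y) ≤ ((a : ℝ) : EReal) * u x + ((b : ℝ) : EReal) * u y) ∧
      LowerSemicontinuousOn u {x : Matrix (Fin K) (Fin K) ℝ | x.PosSemidef} ∧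
      (∀ a b : Matrix (Fin K) (Fin K) ℝ, a.PosSemidef → b.PosSemidef →
        (a - b).PosSemidef → u b ≤ u a)) := by
  obtain ⟨x₀, hx₀, hx₀t⟩ := hne
  have hr : ((u x₀).toReal : EReal) = u x₀ := EReal.coe_toReal hx₀t (hbot x₀ hx₀)
  obtain ⟨s₀, hs₀⟩ : ∃ s₀ : ℝ, u x₀ = s₀ := ⟨_, hr.symm⟩
  have hv : ∀ y, fconj u y ≠ ⊥ := by
    intro y h
    have := FM.le_fconj u y hx₀
    rw [h, hs₀, ← EReal.coe_sub, le_bot_iff] at this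
    exact EReal.coe_ne_bot _ this
  constructor
  · intro h
    refine ⟨fun x y hx hy a b ha hb hab => ?_, ?_, fun a b ha hb hab => ?_⟩
    · rw [← h x hx, ← h y hy, ← h _ ((hx.smul ha).add (hy.smul hb))]
      exact FM.fconj_convex _ hv x y a b ha hb hab
    · intro x hx c hc
      have h1 := FM.fconj_lsc _ hv x hx c (by
        show c < fconj (fconj u) x
        rw [h x hx]; exact hc)
      filter_upwards [h1, self_mem_nhdsWithin] with z hz hz'
      rw [← h z hz']; exact hz
    · rw [← h a ha, ← h b hb]
      exact FM.fconj_mono _ a b hab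
  · rintro ⟨hc, hl, hm⟩ x hx
    apply le_antisymm
    · refine FM.fconj_le _ _ fun y hy => EReal.sub_le_of_le_add ?_
      have h1 := FM.le_fconj u y hx
      have hb := hbot x hx
      induction hux : u x with
      | bot => exact absurd hux hb
      | top => rw [EReal.top_add_of_ne_bot (hv y)]; exact le_top
      | coe r =>
        rw [hux, Matrix.trace_mul_comm] at h1
        rw [add_comm]
        exact (EReal.sub_le_iff_le_add (.inl (EReal.coe_ne_bot r)) (.inl (EReal.coe_ne_top r))).1 h1
    · refine le_of_forall_lt fun c hcx => ?_
      obtain ⟨t, h1, h2⟩ := EReal.lt_iff_exists_real_btwn.1 hcx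
      obtain ⟨y, d, hy, hb, ht⟩ := FM.minorant hc hl hm hx₀ hs₀ hx h2
      refine h1.trans_le (le_trans ?_ (FM.le_fconj (fconj u) x hy))
      have hd : fconj u y ≤ d := by
        refine FM.fconj_le _ _ fun z hz => ?_
        have hzb := hbot z hz
        induction huz : u z with
        | bot => exact absurd huz hzb
        | top => simp
        | coe r =>
          rw [← EReal.coe_sub, Matrix.trace_mul_comm]
          exact EReal.coe_le_coe_iff.2 (hb z hz r huz.le)
      refine le_trans ?_ (EReal.sub_le_sub le_rfl hd)
      rw [← EReal.coe_sub]
      exact EReal.coe_le_coe_iff.2 ht
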